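/- arXiv:1302.6685 — 4 statements merged into one kernel-verified Lean document; each statement's English description precedes it below -/
import Mathlib

section
/- Let G be a digraph on N ≥ 1 nodes with Laplacian L, and suppose G contains a spanning tree. Then, regarding L as a complex matrix, 0 is an algebraically simple eigenvalue of L (i.e., 0 is a root of multiplicity exactly one of the characteristic polynomial of L), and every other eigenvalue z of L satisfies Re(z) > 0. -/
open Matrix Finset Polynomial

/-- The Laplacian of the digraph on `Fin N` with edge relation `E`
(`E j i` means there is an edge from `j` to `i`). -/
def lapMatrix {N : ℕ} (E : Fin N → Fin N → Prop) [DecidableRel E] :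
    Matrix (Fin N) (Fin N) ℝ :=
  Matrix.of fun i j =>
    if i = j then ((Finset.univ.filter (fun k => E k i)).card : ℝ)
    else if E j i then -1 else 0

/-- The digraph contains a spanning tree: some root reaches every node
along directed edges (an edge `(j,i)` allows a step from `j` to `i`). -/
def hasSpanningTree {N : ℕ} (E : Fin N → Fin N → Prop) : Prop :=
  ∃ r : Fin N, ∀ i : Fin N, Relation.ReflTransGen E r i

section Laplacian

variable {N : ℕ} {E : Fin N → Fin N → Prop} [DecidableRel E]

theorem lapMatrix_mulVec_apply (hirr : ∀ i, ¬ E i i) (x : Fin N → ℝ) (i : Fin N) :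
    (lapMatrix E *ᵥ x) i = ∑ j with E j i, (x i - x j) := by
  have h : ∀ j, lapMatrix E i j * x j =
      (if i = j then ((univ.filter (fun k => E k i)).card : ℝ) * x j else 0) +
        (if E j i then -x j else 0) := by
    intro j
    by_cases hij : i = j
    · subst hij
      simp [lapMatrix, hirr i]
    · by_cases hE : E j i <;> simp [lapMatrix, hij, hE]
  simp only [Matrix.mulVec, dotProduct, h, Finset.sum_add_distrib, Finset.sum_ite_eq,
    Finset.mem_univ, if_true, Finset.sum_const, nsmul_eq_mul,
    Finset.sum_filter, sub_eq_add_neg]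

/-- If `L x` is nonpositive, then `x` is maximal at the root. -/
theorem le_root_of_lapMatrix_mulVec_nonpos (hirr : ∀ i, ¬ E i i) {x : Fin N → ℝ} {r : Fin N}
    (hr : ∀ i, Relation.ReflTransGen E r i) (hx : ∀ i, (lapMatrix E *ᵥ x) i ≤ 0) (i : Fin N) :
    x i ≤ x r := by
  have : Nonempty (Fin N) := ⟨r⟩
  obtain ⟨m, hm⟩ := Finite.exists_max x
  suffices h : x m ≤ x r from (hm i).trans h
  have hrm := hr m
  clear hr
  induction hrm using Relation.ReflTransGen.head_induction_on with
  | refl => exact le_rfl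
  | @head a b hab _ ih =>
    have hb := hx b
    rw [lapMatrix_mulVec_apply hirr] at hb
    have hnn : ∀ j ∈ univ.filter (fun j => E j b), 0 ≤ x b - x j := fun j _ => by
      linarith [hm j]
    have hab' : x b - x a ≤ ∑ j with E j b, (x b - x j) :=
      Finset.single_le_sum hnn (by simp [hab])
    linarith

theorem nonneg_of_lapMatrix_mulVec_eq_const (hirr : ∀ i, ¬ E i i) [Nonempty (Fin N)]
    {x : Fin N → ℝ} {c : ℝ} (hx : ∀ i, (lapMatrix E *ᵥ x) i = c) : 0 ≤ c := by
  obtain ⟨m, hm⟩ := Finite.exists_max x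
  rw [← hx m, lapMatrix_mulVec_apply hirr]
  exact Finset.sum_nonneg fun j _ => sub_nonneg.2 (hm j)

theorem eq_zero_of_lapMatrix_mulVec_eq_const (hirr : ∀ i, ¬ E i i) [Nonempty (Fin N)]
    {x : Fin N → ℝ} {c : ℝ} (hx : ∀ i, (lapMatrix E *ᵥ x) i = c) : c = 0 := by
  have h := nonneg_of_lapMatrix_mulVec_eq_const hirr (x := -x) (c := -c)
    (fun i => by rw [Matrix.mulVec_neg, Pi.neg_apply, hx])
  linarith [nonneg_of_lapMatrix_mulVec_eq_const hirr hx]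

theorem eq_root_of_lapMatrix_mulVec_eq_zero (hirr : ∀ i, ¬ E i i) {x : Fin N → ℝ} {r : Fin N}
    (hr : ∀ i, Relation.ReflTransGen E r i) (hx : ∀ i, (lapMatrix E *ᵥ x) i = 0) (i : Fin N) :
    x i = x r := by
  refine le_antisymm (le_root_of_lapMatrix_mulVec_nonpos hirr hr (fun i => (hx i).le) i) ?_
  have h := le_root_of_lapMatrix_mulVec_nonpos hirr (x := -x) hr
    (fun i => by rw [Matrix.mulVec_neg, Pi.neg_apply, hx, neg_zero]) i
  simpa using h

theorem re_map_ofReal_mulVec {m n : Type*} [Fintype n] (A : Matrix m n ℝ) (x : n → ℂ) (i : m) :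
    ((A.map Complex.ofReal *ᵥ x) i).re = (A *ᵥ fun j => (x j).re) i := by
  simp [Matrix.mulVec, dotProduct]

theorem im_map_ofReal_mulVec {m n : Type*} [Fintype n] (A : Matrix m n ℝ) (x : n → ℂ) (i : m) :
    ((A.map Complex.ofReal *ᵥ x) i).im = (A *ᵥ fun j => (x j).im) i := by
  simp [Matrix.mulVec, dotProduct]

theorem map_lapMatrix_mulVec_const (hirr : ∀ i, ¬ E i i) (c : ℂ) :
    (lapMatrix E).map Complex.ofReal *ᵥ (fun _ => c) = 0 := by
  funext i
  apply Complex.ext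
  · rw [re_map_ofReal_mulVec, lapMatrix_mulVec_apply hirr]; simp
  · rw [im_map_ofReal_mulVec, lapMatrix_mulVec_apply hirr]; simp

theorem const_of_map_lapMatrix_mulVec_eq_const (hirr : ∀ i, ¬ E i i) {r : Fin N}
    (hr : ∀ i, Relation.ReflTransGen E r i) {x : Fin N → ℂ} {c : ℂ}
    (hx : (lapMatrix E).map Complex.ofReal *ᵥ x = fun _ => c) : x = fun _ => x r := by
  have : Nonempty (Fin N) := ⟨r⟩
  have hre : ∀ i, (lapMatrix E *ᵥ fun j => (x j).re) i = c.re := fun i => by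
    rw [← re_map_ofReal_mulVec, hx]
  have him : ∀ i, (lapMatrix E *ᵥ fun j => (x j).im) i = c.im := fun i => by
    rw [← im_map_ofReal_mulVec, hx]
  rw [eq_zero_of_lapMatrix_mulVec_eq_const hirr hre] at hre
  rw [eq_zero_of_lapMatrix_mulVec_eq_const hirr him] at him
  funext i
  exact Complex.ext (eq_root_of_lapMatrix_mulVec_eq_zero hirr hr hre i)
    (eq_root_of_lapMatrix_mulVec_eq_zero hirr hr him i)

theorem maxGenEigenspace_map_lapMatrix_zero (hirr : ∀ i, ¬ E i i) {r : Fin N}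
    (hr : ∀ i, Relation.ReflTransGen E r i) :
    Module.End.maxGenEigenspace (toLin' ((lapMatrix E).map Complex.ofReal)) 0 =
      Submodule.span ℂ {fun _ : Fin N => (1 : ℂ)} := by
  ext x
  rw [Module.End.mem_maxGenEigenspace, Submodule.mem_span_singleton, zero_smul, sub_zero]
  constructor
  · rintro ⟨k, hk⟩
    suffices h : x = fun _ => x r from ⟨x r, by rw [h]; ext; simp⟩
    induction k generalizing x with
    | zero =>
      have hx : x = 0 := by simpa using hk
      simp [hx, funext_iff]
    | succ k ih =>
      rw [pow_succ, Module.End.mul_apply] at hk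
      have h := ih _ hk
      rw [toLin'_apply] at h
      exact const_of_map_lapMatrix_mulVec_eq_const hirr hr h
  · rintro ⟨c, rfl⟩
    refine ⟨1, ?_⟩
    rw [pow_one, map_smul, toLin'_apply, map_lapMatrix_mulVec_const hirr, smul_zero]

theorem sum_norm_map_lapMatrix_erase (hirr : ∀ i, ¬ E i i) (i : Fin N) :
    ∑ j ∈ univ.erase i, ‖(lapMatrix E).map Complex.ofReal i j‖ =
      ((univ.filter (fun k => E k i)).card : ℝ) := by
  have h : ∀ j ∈ univ.erase i, ‖(lapMatrix E).map Complex.ofReal i j‖ =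
      if E j i then 1 else 0 := by
    intro j hj
    have hij : i ≠ j := (Finset.ne_of_mem_erase hj).symm
    by_cases hE : E j i <;> simp [lapMatrix, hij, hE]
  rw [Finset.sum_congr rfl h, Finset.sum_erase _ (by simp [hirr i])]
  simp

end Laplacian

theorem Complex.re_pos_of_norm_sub_ofReal_le {z : ℂ} {d : ℝ} (hz : z ≠ 0)
    (h : ‖z - d‖ ≤ d) : 0 < z.re := by
  have hd : 0 ≤ d := (norm_nonneg _).trans h
  have h2 : Complex.normSq (z - d) ≤ d ^ 2 := by
    rw [Complex.normSq_eq_norm_sq]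
    gcongr
  have h3 := Complex.normSq_pos.2 hz
  simp only [Complex.normSq_apply, Complex.sub_re, Complex.sub_im, Complex.ofReal_re,
    Complex.ofReal_im] at h2 h3
  by_contra! hre
  nlinarith [mul_nonneg hd (neg_nonneg.2 hre)]

theorem stmt_4 (N : ℕ) (hN : 1 ≤ N) (E : Fin N → Fin N → Prop) [DecidableRel E]
    (hirr : ∀ i, ¬ E i i) (htree : hasSpanningTree E) :
    (((lapMatrix E).map (Complex.ofReal)).charpoly.rootMultiplicity 0 = 1) ∧
    ∀ z : ℂ, ((lapMatrix E).map (Complex.ofReal)).charpoly.IsRoot z → z ≠ 0 →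
      0 < z.re := by
  obtain ⟨r, hr⟩ := htree
  refine ⟨?_, fun z hz hz0 => ?_⟩
  · rw [← Matrix.charpoly_toLin', ← LinearMap.finrank_maxGenEigenspace_eq,
      maxGenEigenspace_map_lapMatrix_zero hirr hr]
    exact finrank_span_singleton fun h => one_ne_zero (congrFun h r)
  · rw [← Matrix.charpoly_toLin', ← Module.End.hasEigenvalue_iff_isRoot_charpoly] at hz
    obtain ⟨i, hi⟩ := eigenvalue_mem_ball hz
    rw [sum_norm_map_lapMatrix_erase hirr i, mem_closedBall_iff_norm] at hi
    refine Complex.re_pos_of_norm_sub_ofReal_le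
      (d := ((univ.filter (fun k => E k i)).card : ℝ)) hz0 ?_
    simpa [lapMatrix] using hi
end

section
/- Let G be a digraph on N ≥ 1 nodes with Laplacian L, and suppose G contains a spanning tree. Then there exists a unique row vector π = (π₁,…,π_N) ∈ ℝ^N with πᵢ ≥ 0 for all i, Σ_{i=1}^N πᵢ = 1, and πL = 0. -/
open Matrix Finset

/-- Componentwise form of the row action of the Laplacian. -/
theorem vecMul_lapMatrix_apply {N : ℕ} (E : Fin N → Fin N → Prop) [DecidableRel E]
    (hirr : ∀ i, ¬ E i i) (v : Fin N → ℝ) (j : Fin N) :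
    Matrix.vecMul v (lapMatrix E) j =
      v j * ((Finset.univ.filter (fun k => E k j)).card : ℝ) -
        ∑ i, if E j i then v i else 0 := by
  have h : ∀ i, v i * lapMatrix E i j =
      (if i = j then v i * ((Finset.univ.filter (fun k => E k i)).card : ℝ) else 0) -
        if E j i then v i else 0 := by
    intro i
    by_cases hij : i = j
    · subst hij
      simp [lapMatrix, hirr]
    · by_cases hE : E j i <;> simp [lapMatrix, hij, hE]
  simp only [Matrix.vecMul, dotProduct, h, Finset.sum_sub_distrib]
  simp

/-- Every row of the Laplacian sums to zero. -/
theorem lapMatrix_mulVec_one {N : ℕ} (E : Fin N → Fin N → Prop) [DecidableRel E]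
    (hirr : ∀ i, ¬ E i i) : lapMatrix E *ᵥ (fun _ => (1 : ℝ)) = 0 := by
  funext i
  have h : ∀ j, lapMatrix E i j =
      (if i = j then ((Finset.univ.filter (fun k => E k i)).card : ℝ) else 0) -
        if E j i then 1 else 0 := by
    intro j
    by_cases hij : i = j
    · subst hij
      simp [lapMatrix, hirr]
    · by_cases hE : E j i <;> simp [lapMatrix, hij, hE]
  simp only [Matrix.mulVec, dotProduct, h, mul_one, Finset.sum_sub_distrib]
  simp

/-- The left kernel of the Laplacian is closed under entrywise absolute value. -/
theorem vecMul_abs_lapMatrix_eq_zero {N : ℕ} (E : Fin N → Fin N → Prop) [DecidableRel E]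
    (hirr : ∀ i, ¬ E i i) {v : Fin N → ℝ} (hv : Matrix.vecMul v (lapMatrix E) = 0) :
    Matrix.vecMul |v| (lapMatrix E) = 0 := by
  have hle : ∀ j, Matrix.vecMul |v| (lapMatrix E) j ≤ 0 := by
    intro j
    have hj := congrFun hv j
    rw [vecMul_lapMatrix_apply E hirr, Pi.zero_apply, sub_eq_zero] at hj
    rw [vecMul_lapMatrix_apply E hirr, sub_nonpos, Pi.abs_apply]
    calc |v j| * ((Finset.univ.filter (fun k => E k j)).card : ℝ)
        = |v j * ((Finset.univ.filter (fun k => E k j)).card : ℝ)| := by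
          rw [abs_mul, Nat.abs_cast]
      _ ≤ ∑ i, |if E j i then v i else 0| := by
          rw [hj]; exact Finset.abs_sum_le_sum_abs _ _
      _ = ∑ i, if E j i then |v| i else 0 := by
          refine Finset.sum_congr rfl fun i _ => ?_
          split_ifs <;> simp
  have hsum : ∑ j, Matrix.vecMul |v| (lapMatrix E) j = 0 := by
    have h : Matrix.vecMul |v| (lapMatrix E) ⬝ᵥ (fun _ => (1 : ℝ)) = 0 := by
      rw [← Matrix.dotProduct_mulVec, lapMatrix_mulVec_one E hirr, dotProduct_zero]
    simpa [dotProduct] using h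
  funext j
  exact (Finset.sum_eq_zero_iff_of_nonpos fun j _ => hle j).1 hsum j (Finset.mem_univ j)

/-- A nonnegative left null vector of the Laplacian that vanishes at a node also vanishes
at every node reachable from it. -/
theorem eq_zero_of_reflTransGen {N : ℕ} {E : Fin N → Fin N → Prop} [DecidableRel E]
    (hirr : ∀ i, ¬ E i i) {p : Fin N → ℝ} (hp : ∀ i, 0 ≤ p i)
    (hL : Matrix.vecMul p (lapMatrix E) = 0) {r i : Fin N}
    (hr : p r = 0) (hri : Relation.ReflTransGen E r i) : p i = 0 := by
  induction hri with
  | refl => exact hr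
  | @tail j k _ hjk ih =>
    have hj := congrFun hL j
    rw [vecMul_lapMatrix_apply E hirr, ih, zero_mul, zero_sub, Pi.zero_apply, neg_eq_zero,
      Finset.sum_eq_zero_iff_of_nonneg fun i _ => by split_ifs <;> simp [hp]] at hj
    simpa [hjk] using hj k (Finset.mem_univ k)

/-- A left null vector of the Laplacian with zero sum vanishes if the digraph contains a
spanning tree. -/
theorem eq_zero_of_vecMul_lapMatrix_eq_zero {N : ℕ} {E : Fin N → Fin N → Prop}
    [DecidableRel E] (hirr : ∀ i, ¬ E i i) (htree : hasSpanningTree E) {w : Fin N → ℝ}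
    (hL : Matrix.vecMul w (lapMatrix E) = 0) (hsum : ∑ i, w i = 0) : w = 0 := by
  obtain ⟨r, hr⟩ := htree
  have habs := vecMul_abs_lapMatrix_eq_zero E hirr hL
  rcases le_total 0 (w r) with h | h
  · have hz : ∀ i, (|w| - w) i = 0 := fun i =>
      eq_zero_of_reflTransGen hirr (fun i => by simp [le_abs_self])
        (by rw [Matrix.sub_vecMul, habs, hL, sub_zero])
        (by simp [abs_of_nonneg h]) (hr i)
    have hnonneg : ∀ i, 0 ≤ w i := fun i => by
      have := hz i
      simp only [Pi.sub_apply, Pi.abs_apply] at this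
      linarith [abs_nonneg (w i)]
    funext i
    exact (Finset.sum_eq_zero_iff_of_nonneg fun i _ => hnonneg i).1 hsum i (Finset.mem_univ i)
  · have hz : ∀ i, (|w| + w) i = 0 := fun i =>
      eq_zero_of_reflTransGen hirr
        (fun i => by rw [Pi.add_apply, Pi.abs_apply]; linarith [neg_le_abs (w i)])
        (by rw [Matrix.add_vecMul, habs, hL, add_zero])
        (by simp [abs_of_nonpos h]) (hr i)
    have hnonpos : ∀ i, w i ≤ 0 := fun i => by
      have := hz i
      simp only [Pi.add_apply, Pi.abs_apply] at this
      linarith [abs_nonneg (w i)]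
    funext i
    exact (Finset.sum_eq_zero_iff_of_nonpos fun i _ => hnonpos i).1 hsum i (Finset.mem_univ i)

theorem stmt_6 (N : ℕ) (hN : 1 ≤ N) (E : Fin N → Fin N → Prop) [DecidableRel E]
    (hirr : ∀ i, ¬ E i i) (htree : hasSpanningTree E) :
    ∃! π : Fin N → ℝ, (∀ i, 0 ≤ π i) ∧ (∑ i, π i = 1) ∧
      Matrix.vecMul π (lapMatrix E) = 0 := by
  have : Nonempty (Fin N) := ⟨⟨0, hN⟩⟩
  obtain ⟨v, hv, hvL⟩ := Matrix.exists_vecMul_eq_zero_iff.2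
    (Matrix.exists_mulVec_eq_zero_iff.1
      ⟨fun _ => (1 : ℝ), Function.const_ne_zero.2 one_ne_zero, lapMatrix_mulVec_one E hirr⟩)
  have hpos : 0 < ∑ i, |v i| := by
    obtain ⟨i, hi⟩ := Function.ne_iff.1 hv
    exact Finset.sum_pos' (fun i _ => abs_nonneg _) ⟨i, Finset.mem_univ i, abs_pos.2 hi⟩
  refine ⟨(∑ i, |v i|)⁻¹ • |v|, ⟨fun i => ?_, ?_, ?_⟩, ?_⟩
  · exact mul_nonneg (inv_nonneg.2 hpos.le) (abs_nonneg _)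
  · simp only [Pi.smul_apply, Pi.abs_apply, smul_eq_mul, ← Finset.mul_sum]
    exact inv_mul_cancel₀ hpos.ne'
  · rw [Matrix.smul_vecMul, vecMul_abs_lapMatrix_eq_zero E hirr hvL, smul_zero]
  · rintro π ⟨-, hsum, hL⟩
    refine sub_eq_zero.1 (eq_zero_of_vecMul_lapMatrix_eq_zero hirr htree ?_ ?_)
    · rw [Matrix.sub_vecMul, hL, Matrix.smul_vecMul,
        vecMul_abs_lapMatrix_eq_zero E hirr hvL, smul_zero, sub_zero]
    · simp only [Pi.sub_apply, Pi.smul_apply, Pi.abs_apply, smul_eq_mul,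
        Finset.sum_sub_distrib, ← Finset.mul_sum, hsum, inv_mul_cancel₀ hpos.ne', sub_self]
end

section
/- Let N ≥ 1, let E₁,…,E_T be edge relations of digraphs on the node set {1,…,N} (each without self-loops), and let E^u = E₁ ∪ ⋯ ∪ E_T. For x ∈ ℝ^N define U(x) = (1/2)·Σ_{i=1}^N Σ_{j=1}^N (x_j − x_i)² and P^(k)(x) = (1/2)·Σ_{(j,i)∈E_k} (x_j − x_i)². Let e = max over pairs (j,i) ∈ E^u of the number of indices k ∈ {1,…,T} with (j,i) ∈ E_k. If the union digraph (with edge relation E^u) contains a spanning tree, then there exist constants c* > 0 and c** > 0 such that for every x ∈ ℝ^N, c*·U(x) ≤ Σ_{k=1}^T P^(k)(x) ≤ e·c**·U(x). -/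
open Finset

/-- If the squared difference along each edge is at most `c` times an energy `S`, then the squared
difference between two nodes joined by a directed path is at most a constant times `S`. -/
theorem exists_sq_sub_le_mul_of_reflTransGen {ι : Type*} {R : ι → ι → Prop}
    {S : (ι → ℝ) → ℝ} {c : ℝ} (hS : ∀ x, 0 ≤ S x)
    (hR : ∀ x a b, R a b → (x a - x b) ^ 2 ≤ c * S x)
    {r i : ι} (h : Relation.ReflTransGen R r i) :
    ∃ C : ℝ, 0 ≤ C ∧ ∀ x, (x r - x i) ^ 2 ≤ C * S x := by
  induction h with
  | refl => exact ⟨0, le_rfl, fun x => by simp⟩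
  | @tail a b _ hab ih =>
    obtain ⟨C, hC, hle⟩ := ih
    refine ⟨2 * C + 2 * |c|, by positivity, fun x => ?_⟩
    have hc : c * S x ≤ |c| * S x := mul_le_mul_of_nonneg_right (le_abs_self c) (hS x)
    nlinarith [hle x, hR x a b hab, sq_nonneg ((x r - x a) - (x a - x b))]

theorem stmt_10 (N T : ℕ) (hN : 1 ≤ N)
    (E : Fin T → Fin N → Fin N → Prop) [∀ k, DecidableRel (E k)]
    (hirr : ∀ k i, ¬ E k i i)
    (U : (Fin N → ℝ) → ℝ)
    (hU : ∀ x, U x = (1 / 2) * ∑ i : Fin N, ∑ j : Fin N, (x j - x i) ^ 2)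
    (P : Fin T → (Fin N → ℝ) → ℝ)
    (hP : ∀ k x, P k x = (1 / 2) *
      ∑ p ∈ Finset.univ.filter (fun p : Fin N × Fin N => E k p.1 p.2),
        (x p.1 - x p.2) ^ 2)
    (e : ℕ)
    (he : e = (Finset.univ.filter
        (fun p : Fin N × Fin N => ∃ k, E k p.1 p.2)).sup
      (fun p => (Finset.univ.filter (fun k => E k p.1 p.2)).card))
    (htree : hasSpanningTree (fun j i => ∃ k, E k j i)) :
    ∃ cs css : ℝ, 0 < cs ∧ 0 < css ∧ ∀ x : Fin N → ℝ,
      cs * U x ≤ ∑ k, P k x ∧ ∑ k, P k x ≤ (e : ℝ) * css * U x := by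
  have hP0 : ∀ k x, 0 ≤ P k x := fun k x => by
    rw [hP]
    positivity
  have hS0 : ∀ x, 0 ≤ ∑ k, P k x := fun x => sum_nonneg fun k _ => hP0 k x
  have hU0 : ∀ x, U x = (1 / 2) * ∑ p : Fin N × Fin N, (x p.1 - x p.2) ^ 2 := fun x => by
    rw [hU, Fintype.sum_prod_type_right]
  have hedge : ∀ x a b, (∃ k, E k a b) → (x a - x b) ^ 2 ≤ 2 * ∑ k, P k x := by
    rintro x a b ⟨k, hk⟩
    have hle : P k x ≤ ∑ k, P k x :=
      single_le_sum (f := fun k => P k x) (fun k _ => hP0 k x) (mem_univ k)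
    have hterm := single_le_sum (f := fun p : Fin N × Fin N => (x p.1 - x p.2) ^ 2)
      (s := univ.filter fun p : Fin N × Fin N => E k p.1 p.2)
      (fun p _ => sq_nonneg _) (a := (a, b)) (by simpa using hk)
    have hPk := hP k x
    dsimp only at hterm
    linarith
  obtain ⟨r, hr⟩ := htree
  choose C hC hCle using fun i => exists_sq_sub_le_mul_of_reflTransGen hS0 hedge (hr i)
  set D : ℝ := ∑ p : Fin N × Fin N, (C p.1 + C p.2) with hD
  have hD0 : 0 ≤ D := sum_nonneg fun p _ => add_nonneg (hC _) (hC _)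
  have hUD : ∀ x, U x ≤ D * ∑ k, P k x := fun x => by
    rw [hU0, hD, sum_mul, mul_sum]
    refine sum_le_sum fun p _ => ?_
    nlinarith [hCle p.1 x, hCle p.2 x, sq_nonneg ((x r - x p.1) + (x r - x p.2))]
  refine ⟨(D + 1)⁻¹, 1, by positivity, one_pos, fun x => ⟨?_, ?_⟩⟩
  · rw [inv_mul_le_iff₀ (by positivity)]
    linarith [hUD x, hS0 x]
  · simp only [hP, hU0, sum_filter, ← mul_sum, mul_one]
    rw [sum_comm, mul_left_comm]
    refine mul_le_mul_of_nonneg_left ?_ (by norm_num)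
    rw [mul_sum]
    refine sum_le_sum fun p _ => ?_
    rw [← sum_filter, sum_const, nsmul_eq_mul]
    refine mul_le_mul_of_nonneg_right (Nat.cast_le.mpr ?_) (sq_nonneg _)
    by_cases hp : ∃ k, E k p.1 p.2
    · rw [he]
      exact le_sup (f := fun p : Fin N × Fin N => (univ.filter fun k => E k p.1 p.2).card)
        (by simpa using hp)
    · rw [filter_false_of_mem fun k _ hk => hp ⟨k, hk⟩]
      simp
end

section
/- Let N ≥ 1, let E₁,…,E_T be edge relations of digraphs on the node set {1,…,N} (each without self-loops), and suppose each E_k is symmetric (i.e., (j,i) ∈ E_k implies (i,j) ∈ E_k). For x ∈ ℝ^N define U(x) = (1/2)·Σ_{i=1}^N Σ_{j=1}^N (x_j − x_i)² and P^(k)(x) = (1/2)·Σ_{(j,i)∈E_k} (x_j − x_i)². If there exists c > 0 such that c·U(x) ≤ Σ_{k=1}^T P^(k)(x) for all x ∈ ℝ^N, then the union digraph with edge relation E^u = E₁ ∪ ⋯ ∪ E_T contains a spanning tree, i.e., there is a root node r from which every node is reachable along edges of E^u. -/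
open Finset

theorem stmt_11 (N T : ℕ) (hN : 1 ≤ N)
    (E : Fin T → Fin N → Fin N → Prop) [∀ k, DecidableRel (E k)]
    (hirr : ∀ k i, ¬ E k i i)
    (hsymm : ∀ k j i, E k j i → E k i j)
    (U : (Fin N → ℝ) → ℝ)
    (hU : ∀ x, U x = (1 / 2) * ∑ i : Fin N, ∑ j : Fin N, (x j - x i) ^ 2)
    (P : Fin T → (Fin N → ℝ) → ℝ)
    (hP : ∀ k x, P k x = (1 / 2) *
      ∑ p ∈ Finset.univ.filter (fun p : Fin N × Fin N => E k p.1 p.2),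
        (x p.1 - x p.2) ^ 2)
    (c : ℝ) (hc : 0 < c)
    (hbound : ∀ x : Fin N → ℝ, c * U x ≤ ∑ k, P k x) :
    hasSpanningTree (fun j i => ∃ k, E k j i) := by
  classical
  refine ⟨⟨0, hN⟩, fun i => ?_⟩
  by_contra hi
  set r : Fin N := ⟨0, hN⟩
  let R : Fin N → Prop := Relation.ReflTransGen (fun j i => ∃ k, E k j i) r
  let x : Fin N → ℝ := fun v => if R v then 1 else 0
  have hP_zero : ∀ k, P k x = 0 := by
    intro k
    rw [hP, Finset.sum_eq_zero, mul_zero]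
    rintro ⟨a, b⟩ hab
    have hE : E k a b := by simpa using hab
    have hR : R a ↔ R b :=
      ⟨fun h => h.tail ⟨k, hE⟩, fun h => h.tail ⟨k, hsymm k a b hE⟩⟩
    simp [x, hR]
  have hU_pos : 0 < U x := by
    have hterm : (x r - x i) ^ 2 = 1 := by
      have hr : R r := Relation.ReflTransGen.refl
      have hi' : ¬ R i := hi
      simp [x, hr, hi']
    have inner_le : (x r - x i) ^ 2 ≤ ∑ j : Fin N, (x j - x i) ^ 2 :=
      Finset.single_le_sum (f := fun j => (x j - x i) ^ 2)
        (fun j _ => sq_nonneg _) (Finset.mem_univ r)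
    have outer_le : ∑ j : Fin N, (x j - x i) ^ 2 ≤
        ∑ i : Fin N, ∑ j : Fin N, (x j - x i) ^ 2 :=
      Finset.single_le_sum (f := fun i => ∑ j : Fin N, (x j - x i) ^ 2)
        (fun i _ => Finset.sum_nonneg fun j _ => sq_nonneg _) (Finset.mem_univ i)
    rw [hU]
    linarith
  have hle := hbound x
  simp only [hP_zero, Finset.sum_const_zero] at hle
  exact absurd hle (not_le.mpr (mul_pos hc hU_pos))
end
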